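/- (Lemma A.5, high-probability event for RLPO.) Assume the dichotomy data model with query size k ≥ 3, ζ = P_π̄(M1) ∈ (0,1), and 0 < p*(1) < F(ζ) where F(ζ) = (ζ - ζ^k)/(1 - ζ^k - (1-ζ)^k). Then there exists η > 0 such that P( ρ_data - ρ_chosen > η and ρ_chosen > 0 ) → 1 as the dataset size n → ∞. -/

import Mathlib

open MeasureTheory Filter Finset Real

/-- Number of category-1 messages in a query, given the vector of category
indicators of its `k` messages (`true` = category 1). -/
def catCount {k : ℕ} (v : Fin k → Bool) : ℕ := (Finset.univ.filter fun j => v j = true).card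

/-- Probability that the chosen message is of category 1, given the category
pattern `v` of the query: the annotator's type is 1 with probability `p1`; the
choice is uniform on the messages of the annotator's category if present, and
uniform on the whole query otherwise. -/
noncomputable def chooseCat1Prob {k : ℕ} (p1 : ℝ) (v : Fin k → Bool) : ℝ :=
  if ∀ j, v j = true then 1 else if ∃ j, v j = true then p1 else 0

/-- Probability of a single datum pattern `(v, c)` in the dichotomy data model:
`v j` is the category indicator of the `j`-th message of the query (each message
is of category 1 independently with probability `ζ = P_π̄(M1)`), and `c` is the
category of the chosen message. -/
noncomputable def datumProb {k : ℕ} (ζ p1 : ℝ) (d : (Fin k → Bool) × Bool) : ℝ :=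
  (∏ j, if d.1 j then ζ else 1 - ζ) *
    (if d.2 then chooseCat1Prob p1 d.1 else 1 - chooseCat1Prob p1 d.1)

/-- Cramér–Chernoff step: a random variable with finitely many values and positive mean has
Laplace transform below `1` somewhere on the positive half-line. -/
theorem exists_pos_sum_mul_exp_neg_lt_one {α : Type*} [Fintype α] (w h : α → ℝ)
    (hw : ∑ a, w a = 1) (hmean : 0 < ∑ a, w a * h a) :
    ∃ t > 0, ∑ a, w a * Real.exp (-(t * h a)) < 1 := by
  have hd : HasDerivAt (fun t : ℝ => ∑ a, w a * Real.exp (-(t * h a)))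
      (∑ a, w a * (Real.exp (-(0 * h a)) * -(1 * h a))) 0 := by
    refine HasDerivAt.fun_sum fun a _ => ?_
    exact ((((hasDerivAt_id (0 : ℝ)).mul_const (h a)).neg).exp).const_mul (w a)
  have hneg : ∑ a, w a * (Real.exp (-(0 * h a)) * -(1 * h a)) < 0 := by
    simpa using hmean
  have hslope := (hasDerivAt_iff_tendsto_slope.1 hd).eventually (gt_mem_nhds hneg)
  have hright := hslope.filter_mono (nhdsWithin_mono (0 : ℝ)
    (fun x (hx : x ∈ Set.Ioi (0 : ℝ)) => (Set.mem_Ioi.1 hx).ne'))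
  obtain ⟨t, ht, htpos⟩ := (hright.and self_mem_nhdsWithin).exists
  have htpos : 0 < t := htpos
  refine ⟨t, htpos, ?_⟩
  rw [slope_def_field, div_neg_iff] at ht
  simp only [zero_mul, neg_zero, Real.exp_zero, mul_one, hw, sub_zero] at ht
  rcases ht with ht | ht
  · linarith [ht.2]
  · linarith [ht.1]

/-- Under a product of finite distributions, the sum of i.i.d. variables with positive mean is
nonpositive with probability tending to `0`. -/
theorem tendsto_sum_prod_of_sum_nonpos {α : Type*} [Fintype α] (w h : α → ℝ)
    (hw0 : ∀ a, 0 ≤ w a) (hw : ∑ a, w a = 1) (hmean : 0 < ∑ a, w a * h a) :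
    Tendsto (fun n : ℕ => ∑ x : Fin n → α with ∑ i, h (x i) ≤ 0, ∏ i, w (x i))
      atTop (nhds 0) := by
  obtain ⟨t, ht, hlt⟩ := exists_pos_sum_mul_exp_neg_lt_one w h hw hmean
  have hnonneg : 0 ≤ ∑ a, w a * Real.exp (-(t * h a)) :=
    Finset.sum_nonneg fun a _ => mul_nonneg (hw0 a) (Real.exp_pos _).le
  refine squeeze_zero (fun n => Finset.sum_nonneg fun x _ => Finset.prod_nonneg fun i _ => hw0 _)
    (fun n => ?_) (tendsto_pow_atTop_nhds_zero_of_lt_one hnonneg hlt)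
  calc ∑ x : Fin n → α with ∑ i, h (x i) ≤ 0, ∏ i, w (x i)
      ≤ ∑ x : Fin n → α with ∑ i, h (x i) ≤ 0, ∏ i, (w (x i) * Real.exp (-(t * h (x i)))) := by
        refine Finset.sum_le_sum fun x hx => ?_
        rw [Finset.prod_mul_distrib, ← Real.exp_sum, Finset.sum_neg_distrib, ← Finset.mul_sum]
        refine le_mul_of_one_le_right (Finset.prod_nonneg fun i _ => hw0 _) ?_
        exact Real.one_le_exp
          (neg_nonneg.2 (mul_nonpos_of_nonneg_of_nonpos ht.le (Finset.mem_filter.1 hx).2))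
    _ ≤ ∑ x : Fin n → α, ∏ i, (w (x i) * Real.exp (-(t * h (x i)))) :=
        Finset.sum_le_sum_of_subset_of_nonneg (Finset.filter_subset _ _) fun x _ _ =>
          Finset.prod_nonneg fun i _ => mul_nonneg (hw0 _) (Real.exp_pos _).le
    _ = (∑ a, w a * Real.exp (-(t * h a))) ^ n :=
        (Fintype.sum_pow (fun a => w a * Real.exp (-(t * h a))) n).symm

/-- Law of large numbers lower-tail bound for a triangular array with finitely many values,
given only its joint point probabilities (no measurability is assumed). -/
theorem tendsto_measure_sum_nonpos {α Ω : Type*} [Fintype α] [MeasurableSpace Ω]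
    (μ : Measure Ω) (D : (n : ℕ) → Fin n → Ω → α) (w h : α → ℝ)
    (hw0 : ∀ a, 0 ≤ w a) (hw : ∑ a, w a = 1) (hmean : 0 < ∑ a, w a * h a)
    (hD : ∀ n (x : Fin n → α), μ {ω | ∀ i, D n i ω = x i} = ENNReal.ofReal (∏ i, w (x i))) :
    Tendsto (fun n : ℕ => μ {ω | ∑ i, h (D n i ω) ≤ 0}) atTop (nhds 0) := by
  have hlim := ENNReal.tendsto_ofReal (tendsto_sum_prod_of_sum_nonpos w h hw0 hw hmean)
  rw [ENNReal.ofReal_zero] at hlim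
  refine tendsto_of_tendsto_of_tendsto_of_le_of_le tendsto_const_nhds hlim
    (fun n => zero_le) fun n => ?_
  have hsub : {ω | ∑ i, h (D n i ω) ≤ 0} ⊆
      ⋃ x ∈ (Finset.univ.filter fun x : Fin n → α => ∑ i, h (x i) ≤ 0),
        {ω | ∀ i, D n i ω = x i} := by
    intro ω hω
    simp only [Set.mem_iUnion, Finset.mem_filter, Finset.mem_univ, true_and]
    exact ⟨fun i => D n i ω, hω, fun i => rfl⟩
  refine (measure_mono hsub).trans ((measure_biUnion_finset_le _ _).trans ?_)
  rw [ENNReal.ofReal_sum_of_nonneg fun x _ => Finset.prod_nonneg fun i _ => hw0 _]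
  exact (Finset.sum_congr rfl fun x _ => hD n x).le

theorem sum_prod_bernoulli (k : ℕ) (ζ : ℝ) :
    ∑ v : Fin k → Bool, ∏ j, (if v j then ζ else 1 - ζ) = 1 := by
  rw [← Fintype.sum_pow (fun b : Bool => if b then ζ else 1 - ζ) k]
  simp

theorem sum_prod_bernoulli_mul_catCount (k : ℕ) (ζ : ℝ) :
    ∑ v : Fin k → Bool, (∏ j, (if v j then ζ else 1 - ζ)) * (catCount v : ℝ) = k * ζ := by
  have hcoord (i : Fin k) : ∑ v : Fin k → Bool,
      (∏ j, (if v j then ζ else 1 - ζ)) * (if v i then 1 else 0) = ζ := by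
    have hprod (v : Fin k → Bool) : (∏ j, (if v j then ζ else 1 - ζ)) * (if v i then 1 else 0) =
        ∏ j, (if v j then ζ else if j = i then 0 else 1 - ζ) := by
      by_cases hi : v i
      · rw [if_pos hi, mul_one]
        refine Finset.prod_congr rfl fun j _ => ?_
        by_cases hj : j = i
        · subst hj; simp [hi]
        · simp [hj]
      · rw [if_neg hi, mul_zero, Finset.prod_eq_zero (Finset.mem_univ i)]
        simp [hi]
    simp_rw [hprod]
    have hswap := Finset.prod_univ_sum (fun _ : Fin k => (Finset.univ : Finset Bool))
      (fun j b => if b then ζ else if j = i then 0 else 1 - ζ)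
    rw [Fintype.piFinset_univ] at hswap
    rw [← hswap, Finset.prod_eq_single i]
    · simp
    · intro j _ hj
      simp [hj]
    · simp
  have hcount (v : Fin k → Bool) : (catCount v : ℝ) = ∑ i, if v i then (1 : ℝ) else 0 := by
    simp [catCount]
  simp_rw [hcount, Finset.mul_sum]
  rw [Finset.sum_comm]
  simp_rw [hcoord]
  simp

theorem sum_prod_bernoulli_mul_chooseCat1Prob {k : ℕ} (hk : 0 < k) (ζ p1 : ℝ) :
    ∑ v : Fin k → Bool, (∏ j, (if v j then ζ else 1 - ζ)) * chooseCat1Prob p1 v =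
      ζ ^ k + p1 * (1 - ζ ^ k - (1 - ζ) ^ k) := by
  have hchoose (v : Fin k → Bool) : chooseCat1Prob p1 v =
      p1 + (1 - p1) * (if v = fun _ => true then 1 else 0) -
        p1 * (if v = fun _ => false then 1 else 0) := by
    have hne : (fun _ : Fin k => true) ≠ fun _ => false := fun h => by
      simpa using congrFun h ⟨0, hk⟩
    by_cases htrue : v = fun _ => true
    · simp [chooseCat1Prob, htrue, hne]
    · have hall : ¬ ∀ j, v j = true := fun h => htrue (funext h)
      by_cases hfalse : v = fun _ => false
      · have : NeZero k := ⟨hk.ne'⟩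
        simp [chooseCat1Prob, hfalse, hne.symm]
      · have hex : ∃ j, v j = true := by
          by_contra! h
          exact hfalse (funext fun j => by simpa using h j)
        simp [chooseCat1Prob, hall, hex, htrue, hfalse]
  simp_rw [hchoose, mul_sub, mul_add, Finset.sum_sub_distrib, Finset.sum_add_distrib,
    ← Finset.sum_mul, sum_prod_bernoulli, mul_left_comm _ (1 - p1), mul_left_comm _ p1,
    ← Finset.mul_sum]
  simp
  ring

theorem chooseCat1Prob_mem_Icc {k : ℕ} {p1 : ℝ} (hp : p1 ∈ Set.Icc (0 : ℝ) 1)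
    (v : Fin k → Bool) : chooseCat1Prob p1 v ∈ Set.Icc (0 : ℝ) 1 := by
  unfold chooseCat1Prob
  split_ifs
  · simp
  · exact hp
  · simp

theorem datumProb_nonneg {k : ℕ} {ζ p1 : ℝ} (hζ : ζ ∈ Set.Icc (0 : ℝ) 1)
    (hp : p1 ∈ Set.Icc (0 : ℝ) 1) (d : (Fin k → Bool) × Bool) : 0 ≤ datumProb ζ p1 d := by
  have hc := chooseCat1Prob_mem_Icc hp d.1
  refine mul_nonneg (Finset.prod_nonneg fun j _ => ?_) ?_
  · split_ifs
    exacts [hζ.1, sub_nonneg.2 hζ.2]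
  · split_ifs
    exacts [hc.1, sub_nonneg.2 hc.2]

theorem sum_datumProb (k : ℕ) (ζ p1 : ℝ) :
    ∑ d : (Fin k → Bool) × Bool, datumProb ζ p1 d = 1 := by
  rw [← sum_prod_bernoulli k ζ, Fintype.sum_prod_type]
  refine Finset.sum_congr rfl fun v _ => ?_
  simp only [datumProb, Fintype.sum_bool, if_true, Bool.false_eq_true, if_false]
  ring

theorem sum_datumProb_mul_chosen {k : ℕ} (hk : 0 < k) (ζ p1 : ℝ) :
    ∑ d : (Fin k → Bool) × Bool, datumProb ζ p1 d * (if d.2 then 1 else 0) =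
      ζ ^ k + p1 * (1 - ζ ^ k - (1 - ζ) ^ k) := by
  rw [← sum_prod_bernoulli_mul_chooseCat1Prob hk, Fintype.sum_prod_type]
  refine Finset.sum_congr rfl fun v _ => ?_
  simp [datumProb]

theorem sum_datumProb_mul_catCount_div {k : ℕ} (hk : 0 < k) (ζ p1 : ℝ) :
    ∑ d : (Fin k → Bool) × Bool, datumProb ζ p1 d * ((catCount d.1 : ℝ) / k) = ζ := by
  have hk' : (k : ℝ) ≠ 0 := Nat.cast_ne_zero.2 hk.ne'
  simp_rw [← mul_div_assoc, ← Finset.sum_div]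
  rw [div_eq_iff hk', mul_comm ζ, ← sum_prod_bernoulli_mul_catCount, Fintype.sum_prod_type]
  refine Finset.sum_congr rfl fun v _ => ?_
  simp only [datumProb, Fintype.sum_bool, if_true, Bool.false_eq_true, if_false]
  ring

/-- **Lemma A.5 (high-probability event for RLPO).**  Under the dichotomy data
model with query size `k ≥ 3`, `ζ = P_π̄(M1) ∈ (0,1)` and `0 < p*(1) < F(ζ)`
where `F(ζ) = (ζ - ζ^k)/(1 - ζ^k - (1-ζ)^k)`, there exists `η > 0` such that
`P(ρ_data - ρ_chosen > η and ρ_chosen > 0) → 1` as the dataset size `n → ∞`,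
where `ρ_chosen` is the fraction of data whose chosen message is in `M1` and
`ρ_data` is the fraction of all messages in the dataset that belong to `M1`. -/
theorem high_probability_event_rlpo
    (k : ℕ) (hk : 3 ≤ k)
    (ζ p1 : ℝ) (hζ : ζ ∈ Set.Ioo (0:ℝ) 1)
    (hp1pos : 0 < p1) (hp1le : p1 ≤ 1)
    (hF : p1 < (ζ - ζ ^ k) / (1 - ζ ^ k - (1 - ζ) ^ k))
    (Ω : Type*) [MeasurableSpace Ω] (μ : Measure Ω) [IsProbabilityMeasure μ]
    -- the dataset of size `n`: `n` i.i.d. pattern-level data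
    (D : (n : ℕ) → Fin n → Ω → (Fin k → Bool) × Bool)
    (hiid : ∀ n (dd : Fin n → (Fin k → Bool) × Bool),
      μ {ω | ∀ i, D n i ω = dd i} = ENNReal.ofReal (∏ i, datumProb ζ p1 (dd i))) :
    ∃ η > (0:ℝ), Tendsto (fun (n : ℕ) => μ {ω |
        ((1 / (n : ℝ)) * ∑ i, (catCount (D n i ω).1 : ℝ) / k)
            - ((1 / (n : ℝ)) * ∑ i, (if (D n i ω).2 then (1:ℝ) else 0)) > η ∧
        ((1 / (n : ℝ)) * ∑ i, (if (D n i ω).2 then (1:ℝ) else 0)) > 0})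
      atTop (nhds 1) := by
  have hk0 : 0 < k := by omega
  have hζk : ζ ^ k < ζ := pow_lt_self_of_lt_one₀ hζ.1 hζ.2 (by omega)
  have hζk' : (1 - ζ) ^ k < 1 - ζ :=
    pow_lt_self_of_lt_one₀ (by linarith [hζ.2]) (by linarith [hζ.1]) (by omega)
  have hden : 0 < 1 - ζ ^ k - (1 - ζ) ^ k := by linarith
  rw [lt_div_iff₀ hden] at hF
  have hw0 := datumProb_nonneg (k := k) (Set.Ioo_subset_Icc_self hζ) ⟨hp1pos.le, hp1le⟩
  have hw := sum_datumProb k ζ p1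
  have hchosen := sum_datumProb_mul_chosen hk0 ζ p1
  have hdata := sum_datumProb_mul_catCount_div hk0 ζ p1
  set c := ζ ^ k + p1 * (1 - ζ ^ k - (1 - ζ) ^ k) with hc
  have hcpos : 0 < c := add_pos (pow_pos hζ.1 k) (mul_pos hp1pos hden)
  have hcζ : c < ζ := by linarith
  refine ⟨(ζ - c) / 2, by linarith, ?_⟩
  set η := (ζ - c) / 2 with hη
  have hgap := tendsto_measure_sum_nonpos μ D (datumProb ζ p1)
    (fun d => (catCount d.1 : ℝ) / k - (if d.2 then 1 else 0) - η) hw0 hw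
    (by
      simp_rw [mul_sub, Finset.sum_sub_distrib, ← Finset.sum_mul, hdata, hchosen, hw]
      linarith) hiid
  have hpos := tendsto_measure_sum_nonpos μ D (datumProb ζ p1)
    (fun d => if d.2 then 1 else 0) hw0 hw (by rwa [hchosen]) hiid
  have hlower := ENNReal.Tendsto.sub (tendsto_const_nhds (x := (1 : ENNReal)) (f := atTop))
    (hgap.add hpos) (Or.inl ENNReal.one_ne_top)
  rw [add_zero, tsub_zero] at hlower
  refine tendsto_of_tendsto_of_tendsto_of_le_of_le' hlower tendsto_const_nhds ?_
    (Eventually.of_forall fun n => prob_le_one)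
  filter_upwards [eventually_gt_atTop 0] with n hn
  have hn' : (0 : ℝ) < n := Nat.cast_pos.2 hn
  rw [tsub_le_iff_right, ← measure_univ (μ := μ)]
  refine (measure_mono fun ω _ => ?_).trans
    ((measure_union_le _ _).trans (add_le_add_right (measure_union_le _ _) _))
  simp only [Set.mem_union, Set.mem_ofPred_eq]
  by_contra! hω
  obtain ⟨hnot, hdiff, hcount⟩ := hω
  rw [Finset.sum_sub_distrib, Finset.sum_sub_distrib, Finset.sum_const, Finset.card_univ,
    Fintype.card_fin, nsmul_eq_mul] at hdiff
  refine absurd (hnot ?_) (not_le.2 (mul_pos (one_div_pos.2 hn') hcount))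
  rw [← mul_sub, gt_iff_lt, one_div, ← div_eq_inv_mul, lt_div_iff₀ hn']
  linarith
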